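/- arXiv:2307.10670 — 5 statements merged into one kernel-verified Lean document; each statement's English description precedes it below -/
import Mathlib

section
/- Let z = (z₁, z₂, z₃) ∈ ℂ³ satisfy |z₁|² + |z₂|² + |z₃|² = 2α. Then H_t(z) ≥ (|z₃|²/2)·(1 + 2(γδα − 1)t) ≥ 0, and H_t(z) = 0 if and only if z₃ = 0. In particular, since H_t(w₁, w₂, 0) = 0 whenever |w₁|² + |w₂|² = 2α, every point with z₃ = 0 is a minimum of H_t on the constraint sphere, so the image of the ℤ₂-sphere {z₃ = 0} lies in the bottom boundary of the momentum map image of (J, H_t) for all t ∈ [0, 1]. -/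
/-- The Hamiltonian `H_t` on ℂ³ (descending to the ℂP² family):
`H_t(z₁,z₂,z₃) = 2γδtα² + (1 − 2t)|z₃|²/2 + 2γt(Re(z₁z₂z̄₃²) − δ((|z₁|² + |z₂|²)/2)²)`. -/
noncomputable def HtCP2 (α γ δ t : ℝ) (z : ℂ × ℂ × ℂ) : ℝ :=
  2*γ*δ*t*α^2 + (1 - 2*t) * Complex.normSq z.2.2 / 2
    + 2*γ*t*((z.1 * z.2.1 * (starRingEnd ℂ z.2.2)^2).re
        - δ * ((Complex.normSq z.1 + Complex.normSq z.2.1)/2)^2)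

lemma HtCP2_re_bound (a b c : ℂ) :
    -((Complex.normSq a + Complex.normSq b) / 2 * Complex.normSq c)
      ≤ (a * b * (starRingEnd ℂ c)^2).re := by
  have h1 := (abs_le.mp (Complex.abs_re_le_norm (a * b * (starRingEnd ℂ c)^2))).1
  have h2 : ‖a * b * (starRingEnd ℂ c)^2‖ = ‖a‖ * ‖b‖ * ‖c‖^2 := by
    rw [norm_mul, norm_mul, norm_pow, RCLike.norm_conj]
  rw [h2] at h1
  simp only [Complex.normSq_eq_norm_sq]
  have h3 : ‖a‖ * ‖b‖ ≤ (‖a‖^2 + ‖b‖^2) / 2 := by nlinarith [sq_nonneg (‖a‖ - ‖b‖)]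
  have h4 := mul_le_mul_of_nonneg_right h3 (sq_nonneg ‖c‖)
  linarith

lemma HtCP2_lower (α γ δ t : ℝ) (hγ0 : 0 < γ) (hδ : 2 ≤ δ) (ht0 : 0 ≤ t)
    (z : ℂ × ℂ × ℂ)
    (hz : Complex.normSq z.1 + Complex.normSq z.2.1 + Complex.normSq z.2.2 = 2*α) :
    (Complex.normSq z.2.2 / 2) * (1 + 2*(γ*δ*α - 1)*t) ≤ HtCP2 α γ δ t z := by
  have hb := HtCP2_re_bound z.1 z.2.1 z.2.2
  unfold HtCP2
  have hn : 0 ≤ (Complex.normSq z.1 + Complex.normSq z.2.1) / 2 := by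
    have := Complex.normSq_nonneg z.1
    have := Complex.normSq_nonneg z.2.1
    positivity
  have hc := Complex.normSq_nonneg z.2.2
  generalize (z.1 * z.2.1 * (starRingEnd ℂ z.2.2)^2).re = R at *
  have hα : α = (Complex.normSq z.1 + Complex.normSq z.2.1) / 2 + Complex.normSq z.2.2 / 2 := by
    linarith
  generalize (Complex.normSq z.1 + Complex.normSq z.2.1) / 2 = n at *
  generalize Complex.normSq z.2.2 = c at *
  subst hα
  have h1 : 0 ≤ 2 * γ * t * (R + n * c) :=
    mul_nonneg (by positivity) (by linarith)
  have h2 : 0 ≤ γ * t * n * c * (δ - 2) :=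
    mul_nonneg (by positivity) (by linarith)
  nlinarith [h1, h2]

lemma HtCP2_zero (α γ δ t : ℝ) (w₁ w₂ : ℂ)
    (h : Complex.normSq w₁ + Complex.normSq w₂ = 2*α) :
    HtCP2 α γ δ t (w₁, w₂, 0) = 0 := by
  simp only [HtCP2, h]
  simp
  ring

/-- Let `z ∈ ℂ³` satisfy `|z₁|² + |z₂|² + |z₃|² = 2α`.  Then
`H_t(z) ≥ (|z₃|²/2)(1 + 2(γδα − 1)t) ≥ 0`, with `H_t(z) = 0` iff `z₃ = 0`.
In particular `H_t(w₁, w₂, 0) = 0` whenever `|w₁|² + |w₂|² = 2α`, and every point with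
`z₃ = 0` is a minimum of `H_t` on the constraint sphere. -/
theorem stmt14 (α γ δ t : ℝ) (hα : 0 < α) (hγ0 : 0 < γ) (hγ : γ < 1/(4*α))
    (hδ : 1/(2*γ*α) < δ) (ht0 : 0 ≤ t) (ht1 : t ≤ 1)
    (z : ℂ × ℂ × ℂ)
    (hz : Complex.normSq z.1 + Complex.normSq z.2.1 + Complex.normSq z.2.2 = 2*α) :
    (Complex.normSq z.2.2 / 2) * (1 + 2*(γ*δ*α - 1)*t) ≤ HtCP2 α γ δ t z ∧
    0 ≤ (Complex.normSq z.2.2 / 2) * (1 + 2*(γ*δ*α - 1)*t) ∧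
    (HtCP2 α γ δ t z = 0 ↔ z.2.2 = 0) ∧
    (∀ w₁ w₂ : ℂ, Complex.normSq w₁ + Complex.normSq w₂ = 2*α →
      HtCP2 α γ δ t (w₁, w₂, 0) = 0) ∧
    (z.2.2 = 0 → ∀ z' : ℂ × ℂ × ℂ,
      Complex.normSq z'.1 + Complex.normSq z'.2.1 + Complex.normSq z'.2.2 = 2*α →
      HtCP2 α γ δ t z ≤ HtCP2 α γ δ t z') := by
  have hγα : 0 < γ * α := mul_pos hγ0 hα
  have hγ' : 4 * (γ * α) < 1 := by
    rw [lt_div_iff₀ (by positivity)] at hγ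
    linarith
  have hδ' : 1 < 2 * (γ * δ * α) := by
    rw [div_lt_iff₀ (by positivity)] at hδ
    linarith
  have hδ2 : 2 ≤ δ := by
    by_contra hcon
    push Not at hcon
    nlinarith [mul_lt_mul_of_pos_left hcon hγα]
  have hpos : 0 < 1 + 2*(γ*δ*α - 1)*t := by
    rcases ht0.eq_or_lt with h | h
    · simp [← h]
    · nlinarith [mul_pos h (sub_pos.mpr hδ')]
  have hlow := HtCP2_lower α γ δ t hγ0 hδ2 ht0
  have hnn : ∀ c : ℂ, 0 ≤ (Complex.normSq c / 2) * (1 + 2*(γ*δ*α - 1)*t) := fun c =>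
    mul_nonneg (div_nonneg (Complex.normSq_nonneg c) (by norm_num)) hpos.le
  have hzero : z.2.2 = 0 → HtCP2 α γ δ t z = 0 := by
    obtain ⟨a, b, c⟩ := z
    intro h
    simp only at h
    subst h
    exact HtCP2_zero α γ δ t a b (by simpa using hz)
  refine ⟨hlow z hz, hnn _, ⟨fun h => ?_, hzero⟩, HtCP2_zero α γ δ t, fun h z' hz' => ?_⟩
  · by_contra hne
    have h1 := hlow z hz
    have h2 := mul_pos (half_pos (Complex.normSq_pos.mpr hne)) hpos
    linarith
  · rw [hzero h]
    exact (hnn _).trans (hlow z' hz')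
end

section
/- For every t ∈ (t⁻, t⁺): one has 0 < X⁺ < α; for X ∈ (0, α), G_t(X) ∈ [−1, 1] if and only if X ≤ X⁺, and G_t(X) > 1 for X ∈ (X⁺, α); the quantity h(γ, δ, t) = (πα − ∫₀^{X⁺} arccos(G_t(X)) dX)/(2π) satisfies h(γ, δ, t) → α/2 as t → t⁻ from above and h(γ, δ, t) → (α/2)·√((δ − 2)/(δ + 2)) as t → t⁺ from below; and for every h₀ ∈ (0, α/2) there exist γ ∈ (0, 1/(4α)), δ > 1/(2γα) and t ∈ (t⁻, t⁺) such that h(γ, δ, t) = h₀. -/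
open Topology

/-- `t⁻ = 1/(2(1 + 2γα))`. -/
noncomputable def tmCP (α γ : ℝ) : ℝ := 1/(2*(1 + 2*γ*α))

/-- `t⁺ = 1/(2(1 − 2γα))`. -/
noncomputable def tpCP (α γ : ℝ) : ℝ := 1/(2*(1 - 2*γ*α))

/-- `G_t(X) = (1 − 2t + 2γδtX)/(4γt(α − X))`. -/
noncomputable def GCP (α γ δ t X : ℝ) : ℝ := (1 - 2*t + 2*γ*δ*t*X)/(4*γ*t*(α - X))

/-- `X⁺ = (t/t⁻ − 1)/(2γt(δ + 2))`. -/
noncomputable def XplusCP (α γ δ t : ℝ) : ℝ := (t/tmCP α γ - 1)/(2*γ*t*(δ + 2))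

/-- The height invariant `h(γ, δ, t) = (πα − ∫₀^{X⁺} arccos(G_t(X)) dX)/(2π)`. -/
noncomputable def heightCP (α γ δ t : ℝ) : ℝ :=
  (Real.pi * α - ∫ X in (0:ℝ)..(XplusCP α γ δ t), Real.arccos (GCP α γ δ t X))
    / (2*Real.pi)

theorem aux_X (α γ δ t : ℝ) (hα : 0 < α) (hγ : 0 < γ) :
    XplusCP α γ δ t = (2*t*(1+2*γ*α) - 1)/(2*γ*t*(δ+2)) := by
  have : 0 < 1 + 2*γ*α := by positivity
  unfold XplusCP tmCP
  congr 1
  field_simp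

theorem aux_G1 (α γ δ t X : ℝ) (hα : 0 < α) (hγ : 0 < γ) (hδ : 2 < δ) (ht : 0 < t) (hX : X < α) :
    1 < GCP α γ δ t X ↔ XplusCP α γ δ t < X := by
  have h1 : 0 < 4*γ*t*(α - X) := mul_pos (by positivity) (by linarith)
  have h2 : 0 < 2*γ*t*(δ+2) := by positivity
  rw [aux_X α γ δ t hα hγ, GCP, lt_div_iff₀ h1, div_lt_iff₀ h2]
  constructor <;> intro h <;> nlinarith

theorem aux_Gm (α γ δ t X : ℝ) (hγ : 0 < γ) (hδ : 2 < δ) (ht : 0 < t)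
    (h0 : 2*t*(1 - 2*γ*α) ≤ 1) (hX0 : 0 ≤ X) (hX : X < α) :
    -1 ≤ GCP α γ δ t X := by
  have h1 : 0 < 4*γ*t*(α - X) := mul_pos (by positivity) (by linarith)
  rw [GCP, le_div_iff₀ h1]
  have : 0 ≤ 2*γ*t*((δ-2)*X) := by
    have : 0 ≤ (δ-2)*X := mul_nonneg (by linarith) hX0
    positivity
  nlinarith

theorem aux_Xlt (α γ δ t : ℝ) (hα : 0 < α) (hγ : 0 < γ) (hδ : 2 < δ) (ht : 0 < t)
    (hd : 1 < 2*γ*α*δ) (h1 : t ≤ 1) : XplusCP α γ δ t < α := by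
  have h2 : 0 < 2*γ*t*(δ+2) := by positivity
  rw [aux_X α γ δ t hα hγ, div_lt_iff₀ h2]
  nlinarith [mul_lt_mul_of_pos_left hd ht]

theorem aux_int (α γ δ t a b : ℝ) :
    IntervalIntegrable (fun X => Real.arccos (GCP α γ δ t X)) MeasureTheory.volume a b := by
  have hm : Measurable (fun X => Real.arccos (GCP α γ δ t X)) := by
    unfold GCP
    exact Real.continuous_arccos.measurable.comp (by fun_prop)
  apply (intervalIntegrable_const (c := Real.pi)).mono_fun hm.aestronglyMeasurable
  refine Filter.Eventually.of_forall fun x => ?_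
  simp only [Real.norm_eq_abs, abs_of_nonneg (Real.arccos_nonneg _), abs_of_nonneg Real.pi_pos.le]
  exact Real.arccos_le_pi _

theorem aux_F (α γ δ t : ℝ) (hα : 0 < α) (hγ : 0 < γ) (hδ : 2 < δ) (ht : 0 < t)
    (hlt : XplusCP α γ δ t < α) :
    ∫ X in (0:ℝ)..(XplusCP α γ δ t), Real.arccos (GCP α γ δ t X)
      = ∫ X in (0:ℝ)..α, Real.arccos (GCP α γ δ t X) := by
  rw [← intervalIntegral.integral_add_adjacent_intervals (aux_int α γ δ t 0 (XplusCP α γ δ t))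
    (aux_int α γ δ t (XplusCP α γ δ t) α)]
  have : ∫ X in (XplusCP α γ δ t)..α, Real.arccos (GCP α γ δ t X) = 0 := by
    rw [intervalIntegral.integral_of_le hlt.le, MeasureTheory.integral_Ioc_eq_integral_Ioo]
    rw [MeasureTheory.setIntegral_congr_fun (g := fun _ => (0:ℝ)) measurableSet_Ioo]
    · simp
    · intro X hX
      exact Real.arccos_eq_zero.2 ((aux_G1 α γ δ t X hα hγ hδ ht hX.2).2 hX.1).le
  rw [this, add_zero]

theorem aux_cont (α γ δ t : ℝ) (hα : 0 < α) (hγ : 0 < γ) (ht : 0 < t) :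
    ContinuousAt (fun t => ∫ X in (0:ℝ)..α, Real.arccos (GCP α γ δ t X)) t := by
  apply intervalIntegral.continuousAt_of_dominated_interval (bound := fun _ => Real.pi)
  · refine Filter.Eventually.of_forall fun s => ?_
    exact (aux_int α γ δ s 0 α).aestronglyMeasurable_restrict_uIoc
  · refine Filter.Eventually.of_forall fun s => Filter.Eventually.of_forall fun x _ => ?_
    rw [Real.norm_eq_abs, abs_of_nonneg (Real.arccos_nonneg _)]
    exact Real.arccos_le_pi _
  · exact intervalIntegrable_const
  · have : ∀ᵐ x : ℝ, x ≠ α := MeasureTheory.Measure.ae_ne _ _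
    filter_upwards [this] with x hx _
    apply Real.continuous_arccos.continuousAt.comp
    unfold GCP
    have h : 4*γ*t*(α - x) ≠ 0 := mul_ne_zero (by positivity) (sub_ne_zero.2 hx.symm)
    fun_prop (disch := exact h)

theorem aux_val (α δ : ℝ) (hα : 0 < α) (hδ : 2 < δ) :
    ∫ X in (0:ℝ)..(4*α/(δ+2)), Real.arccos ((δ/2*X-α)/(α-X))
      = Real.pi * α * (1 - Real.sqrt ((δ - 2)/(δ + 2))) := by
  set k := Real.sqrt ((δ - 2)/(δ + 2)) with hk
  have hkpos : 0 < k := Real.sqrt_pos.2 (div_pos (by linarith) (by linarith))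
  have hk2 : k^2 = (δ - 2)/(δ + 2) := Real.sq_sqrt (div_pos (by linarith) (by linarith)).le
  have hb : 4*α/(δ+2) < α := by
    rw [div_lt_iff₀ (by linarith)]; nlinarith
  have hb0 : 0 ≤ 4*α/(δ+2) := by positivity
  have hne : ∀ X ∈ Set.Icc 0 (4*α/(δ+2)), α - X ≠ 0 := fun X hX => by
    have := hX.2; intro h; linarith
  have hcu : ContinuousOn (fun X => Real.arccos ((δ/2*X-α)/(α-X))) (Set.Icc 0 (4*α/(δ+2))) := by
    apply Real.continuous_arccos.comp_continuousOn
    apply ContinuousOn.div (by fun_prop) (by fun_prop) hne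
  have key := intervalIntegral.integral_eq_sub_of_hasDerivAt_of_le hb0
    (f := fun X => (X-α) * Real.arccos ((δ/2*X-α)/(α-X))
      + k * α * Real.arccos (((δ/2+1)*X-α)/α))
    (f' := fun X => Real.arccos ((δ/2*X-α)/(α-X))) ?_ ?_ ?_
  · rw [key]
    have e1 : (δ/2*(4*α/(δ+2))-α)/(α-4*α/(δ+2)) = 1 := by
      rw [div_eq_one_iff_eq (by linarith)]
      field_simp; ring
    have e2 : ((δ/2+1)*(4*α/(δ+2))-α)/α = 1 := by
      field_simp; ring
    have e3 : (δ/2*0-α)/(α-0) = -1 := by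
      rw [div_eq_iff (by linarith)]; ring
    have e4 : ((δ/2+1)*0-α)/α = -1 := by
      rw [div_eq_iff (by linarith)]; ring
    simp only [e1, e2, e3, e4, Real.arccos_one, Real.arccos_neg_one]
    ring
  · refine ContinuousOn.add (ContinuousOn.mul (by fun_prop) hcu) ?_
    exact (continuous_const.mul (Real.continuous_arccos.comp (by fun_prop))).continuousOn
  · intro X hX
    have hX0 := hX.1
    have hXα : 0 < α - X := by linarith [hX.2]
    have hX2 : 0 < 2*α - (δ/2+1)*X := by
      have := hX.2
      rw [lt_div_iff₀ (by linarith)] at this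
      linarith
    set u := (δ/2*X-α)/(α-X) with hu
    set w := ((δ/2+1)*X-α)/α with hw
    have hw1 : 1 - w^2 = (δ/2+1)*X*(2*α - (δ/2+1)*X)/α^2 := by
      rw [hw]; field_simp; ring
    have hwpos : 0 < 1 - w^2 := by rw [hw1]; positivity
    have hu1 : 1 - u^2 = (k*α/(α-X))^2 * (1 - w^2) := by
      rw [hw1, div_pow (k*α), mul_pow k, hk2, hu]; field_simp; ring
    have hupos : 0 < 1 - u^2 := by rw [hu1]; positivity
    have hsu : Real.sqrt (1 - u^2) = k*α/(α-X) * Real.sqrt (1-w^2) := by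
      rw [hu1, Real.sqrt_mul (by positivity), Real.sqrt_sq (by positivity)]
    have hs : 0 < Real.sqrt (1-w^2) := Real.sqrt_pos.2 hwpos
    have du : HasDerivAt (fun X => (δ/2*X-α)/(α-X)) ((δ/2-1)*α/(α-X)^2) X := by
      have := (((hasDerivAt_id X).const_mul (δ/2)).sub_const α).div
        ((hasDerivAt_id X).const_sub α) hXα.ne'
      refine this.congr_deriv ?_
      simp only [id]
      ring
    have dw : HasDerivAt (fun X => ((δ/2+1)*X-α)/α) ((δ/2+1)/α) X := by
      have := (((hasDerivAt_id X).const_mul (δ/2+1)).sub_const α).div_const α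
      simpa using this
    have dau := (Real.hasDerivAt_arccos (x := u) (by intro h; rw [h] at hupos; norm_num at hupos)
      (by intro h; rw [h] at hupos; norm_num at hupos)).comp X du
    have daw := (Real.hasDerivAt_arccos (x := w) (by intro h; rw [h] at hwpos; norm_num at hwpos)
      (by intro h; rw [h] at hwpos; norm_num at hwpos)).comp X dw
    have := (((hasDerivAt_id X).sub_const α).mul dau).add (daw.const_mul (k*α))
    refine this.congr_deriv ?_
    simp only [id, Function.comp, ← hu]
    rw [hsu]
    generalize Real.sqrt (1-w^2) = s at hs
    have hk3 : k^2*(δ+2) = δ - 2 := by rw [hk2]; field_simp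
    field_simp
    linear_combination (-(α-X))*hk3
  · apply ContinuousOn.intervalIntegrable
    rwa [Set.uIcc_of_le hb0]

theorem aux_main (α γ δ : ℝ) (hα : 0 < α) (hγ : 0 < γ) (hγ2 : γ < 1/(4*α)) (hδ : 1/(2*γ*α) < δ) :
    2 < δ ∧ 1 < 2*γ*α*δ ∧ 4*γ*α < 1 ∧ 0 < tmCP α γ ∧ tmCP α γ < tpCP α γ ∧ tpCP α γ < 1 ∧
    (∀ t, tmCP α γ ≤ t → 1 ≤ 2*t*(1+2*γ*α)) ∧ (∀ t, t ≤ tpCP α γ → 2*t*(1-2*γ*α) ≤ 1) ∧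
    (∀ t, tmCP α γ < t → 1 < 2*t*(1+2*γ*α)) := by
  have h1 : 4*γ*α < 1 := by
    rw [lt_div_iff₀ (by positivity)] at hγ2; linarith
  have h2 : 1 < 2*γ*α*δ := by
    rw [div_lt_iff₀ (by positivity)] at hδ; linarith
  have h3 : 0 < γ*α := by positivity
  have h4 : 0 < 1 - 2*γ*α := by linarith
  refine ⟨by nlinarith, h2, h1, by unfold tmCP; positivity, ?_, ?_, ?_, ?_, ?_⟩
  · unfold tmCP tpCP
    apply one_div_lt_one_div_of_lt <;> linarith
  · unfold tpCP
    rw [div_lt_one] <;> linarith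
  · intro t ht
    unfold tmCP at ht
    rw [div_le_iff₀ (by positivity)] at ht; linarith
  · intro t ht
    unfold tpCP at ht
    rw [le_div_iff₀ (by positivity)] at ht; linarith
  · intro t ht
    unfold tmCP at ht
    rw [div_lt_iff₀ (by positivity)] at ht; linarith

theorem aux_Fm (α γ δ : ℝ) (hα : 0 < α) (hγ : 0 < γ) (hγ2 : γ < 1/(4*α)) (hδ : 1/(2*γ*α) < δ) :
    ∫ X in (0:ℝ)..α, Real.arccos (GCP α γ δ (tmCP α γ) X) = 0 := by
  obtain ⟨h2, hd, h1, hm0, hmp, hp1, -, -, -⟩ := aux_main α γ δ hα hγ hγ2 hδ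
  rw [← aux_F α γ δ _ hα hγ h2 hm0 (aux_Xlt α γ δ _ hα hγ h2 hm0 hd (by linarith))]
  have : XplusCP α γ δ (tmCP α γ) = 0 := by
    unfold XplusCP; rw [div_self hm0.ne']; simp
  rw [this, intervalIntegral.integral_same]

theorem aux_Fp (α γ δ : ℝ) (hα : 0 < α) (hγ : 0 < γ) (hγ2 : γ < 1/(4*α)) (hδ : 1/(2*γ*α) < δ) :
    ∫ X in (0:ℝ)..α, Real.arccos (GCP α γ δ (tpCP α γ) X)
      = Real.pi * α * (1 - Real.sqrt ((δ - 2)/(δ + 2))) := by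
  obtain ⟨h2, hd, h1, hm0, hmp, hp1, -, -, -⟩ := aux_main α γ δ hα hγ hγ2 hδ
  have hp0 := hm0.trans hmp
  have heq : 2 * tpCP α γ * (1 - 2*γ*α) = 1 := by
    have : 0 < 1 - 2*γ*α := by nlinarith [mul_pos hγ hα]
    unfold tpCP; field_simp
  rw [← aux_F α γ δ _ hα hγ h2 hp0 (aux_Xlt α γ δ _ hα hγ h2 hp0 hd hp1.le), aux_X _ _ _ _ hα hγ]
  rw [← aux_val α δ hα h2]
  generalize tpCP α γ = t at *
  have e : (2*t*(1+2*γ*α) - 1)/(2*γ*t*(δ+2)) = 4*α/(δ+2) := by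
    rw [div_eq_div_iff (by positivity) (by positivity)]
    linear_combination (δ+2)*heq
  rw [e]
  congr 1
  funext X
  congr 1
  unfold GCP
  rw [show 1 - 2*t + 2*γ*δ*t*X = (4*γ*t) * (δ/2*X-α) by linear_combination -heq]
  rw [mul_div_mul_left _ _ (by positivity)]

theorem aux_h (α γ δ t : ℝ) (hα : 0 < α) (hγ : 0 < γ) (hγ2 : γ < 1/(4*α)) (hδ : 1/(2*γ*α) < δ)
    (ht : t ∈ Set.Icc (tmCP α γ) (tpCP α γ)) :
    heightCP α γ δ t
      = (Real.pi * α - ∫ X in (0:ℝ)..α, Real.arccos (GCP α γ δ t X)) / (2*Real.pi) := by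
  obtain ⟨h2, hd, h1, hm0, hmp, hp1, -, -, -⟩ := aux_main α γ δ hα hγ hγ2 hδ
  have ht0 := hm0.trans_le ht.1
  rw [heightCP, aux_F α γ δ _ hα hγ h2 ht0 (aux_Xlt α γ δ _ hα hγ h2 ht0 hd (by linarith [ht.2]))]

theorem aux_hm (α γ δ : ℝ) (hα : 0 < α) (hγ : 0 < γ) (hγ2 : γ < 1/(4*α)) (hδ : 1/(2*γ*α) < δ) :
    heightCP α γ δ (tmCP α γ) = α/2 := by
  obtain ⟨h2, hd, h1, hm0, hmp, hp1, -, -, -⟩ := aux_main α γ δ hα hγ hγ2 hδ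
  rw [aux_h α γ δ _ hα hγ hγ2 hδ ⟨le_rfl, hmp.le⟩, aux_Fm α γ δ hα hγ hγ2 hδ]
  field_simp
  ring

theorem aux_hp (α γ δ : ℝ) (hα : 0 < α) (hγ : 0 < γ) (hγ2 : γ < 1/(4*α)) (hδ : 1/(2*γ*α) < δ) :
    heightCP α γ δ (tpCP α γ) = (α/2) * Real.sqrt ((δ - 2)/(δ + 2)) := by
  obtain ⟨h2, hd, h1, hm0, hmp, hp1, -, -, -⟩ := aux_main α γ δ hα hγ hγ2 hδ
  rw [aux_h α γ δ _ hα hγ hγ2 hδ ⟨hmp.le, le_rfl⟩, aux_Fp α γ δ hα hγ hγ2 hδ]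
  field_simp
  ring

theorem aux_hcont (α γ δ : ℝ) (hα : 0 < α) (hγ : 0 < γ) (hγ2 : γ < 1/(4*α)) (hδ : 1/(2*γ*α) < δ) :
    ContinuousOn (fun t => heightCP α γ δ t) (Set.Icc (tmCP α γ) (tpCP α γ)) := by
  obtain ⟨h2, hd, h1, hm0, hmp, hp1, -, -, -⟩ := aux_main α γ δ hα hγ hγ2 hδ
  refine ContinuousOn.congr (f := fun t => (Real.pi * α -
    ∫ X in (0:ℝ)..α, Real.arccos (GCP α γ δ t X)) / (2*Real.pi)) ?_
    (fun t ht => aux_h α γ δ t hα hγ hγ2 hδ ht)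
  intro t ht
  exact ((continuousAt_const.sub (aux_cont α γ δ t hα hγ (hm0.trans_le ht.1))).div_const
    _).continuousWithinAt

/-- For every `t ∈ (t⁻, t⁺)`: `0 < X⁺ < α`; for `X ∈ (0, α)`, `G_t(X) ∈ [−1, 1]` iff
`X ≤ X⁺`, and `G_t(X) > 1` for `X ∈ (X⁺, α)`; the height invariant tends to `α/2` as
`t → t⁻⁺` and to `(α/2)√((δ − 2)/(δ + 2))` as `t → t⁺⁻`; and every value
`h₀ ∈ (0, α/2)` is attained by the height invariant for some admissible `(γ, δ, t)`. -/
theorem stmt15 (α : ℝ) (hα : 0 < α) :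
    (∀ γ δ : ℝ, 0 < γ → γ < 1/(4*α) → 1/(2*γ*α) < δ →
      (∀ t ∈ Set.Ioo (tmCP α γ) (tpCP α γ),
        (0 < XplusCP α γ δ t ∧ XplusCP α γ δ t < α) ∧
        (∀ X ∈ Set.Ioo (0:ℝ) α,
          (GCP α γ δ t X ∈ Set.Icc (-1:ℝ) 1 ↔ X ≤ XplusCP α γ δ t)) ∧
        (∀ X ∈ Set.Ioo (XplusCP α γ δ t) α, 1 < GCP α γ δ t X)) ∧
      Filter.Tendsto (fun t => heightCP α γ δ t) (𝓝[>] (tmCP α γ)) (𝓝 (α/2)) ∧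
      Filter.Tendsto (fun t => heightCP α γ δ t) (𝓝[<] (tpCP α γ))
        (𝓝 ((α/2) * Real.sqrt ((δ - 2)/(δ + 2))))) ∧
    (∀ h₀ ∈ Set.Ioo (0:ℝ) (α/2), ∃ γ δ t : ℝ,
      0 < γ ∧ γ < 1/(4*α) ∧ 1/(2*γ*α) < δ ∧
      t ∈ Set.Ioo (tmCP α γ) (tpCP α γ) ∧ heightCP α γ δ t = h₀) := by
  constructor
  · intro γ δ hγ hγ2 hδ
    obtain ⟨h2, hd, h1, hm0, hmp, hp1, hm, hp, hm'⟩ := aux_main α γ δ hα hγ hγ2 hδ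
    have hc := aux_hcont α γ δ hα hγ hγ2 hδ
    refine ⟨?_, ?_, ?_⟩
    · intro t ht
      have ht0 := hm0.trans ht.1
      have hlt := aux_Xlt α γ δ t hα hγ h2 ht0 hd (by linarith [ht.2])
      have hpos : 0 < XplusCP α γ δ t := by
        rw [aux_X α γ δ t hα hγ]
        have := hm' t ht.1
        exact div_pos (by linarith) (by positivity)
      refine ⟨⟨hpos, hlt⟩, ?_, ?_⟩
      · intro X hX
        have := aux_G1 α γ δ t X hα hγ h2 ht0 hX.2
        rw [← not_lt, ← this, not_lt]
        exact ⟨fun h => h.2, fun h => ⟨aux_Gm α γ δ t X hγ h2 ht0 (hp t ht.2.le) hX.1.le hX.2, h⟩⟩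
      · intro X hX
        exact (aux_G1 α γ δ t X hα hγ h2 ht0 hX.2).2 hX.1
    · have := hc _ (Set.left_mem_Icc.2 hmp.le)
      rw [ContinuousWithinAt, aux_hm α γ δ hα hγ hγ2 hδ] at this
      rw [← nhdsWithin_Ioo_eq_nhdsGT hmp]
      exact this.mono_left (nhdsWithin_mono _ Set.Ioo_subset_Icc_self)
    · have := hc _ (Set.right_mem_Icc.2 hmp.le)
      rw [ContinuousWithinAt, aux_hp α γ δ hα hγ hγ2 hδ] at this
      rw [← nhdsWithin_Ioo_eq_nhdsLT hmp]
      exact this.mono_left (nhdsWithin_mono _ Set.Ioo_subset_Icc_self)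
  · intro h₀ hh
    obtain ⟨hh0, hh1⟩ := hh
    -- choose δ close to 2
    have hδex : ∃ δ : ℝ, 2 < δ ∧ (α/2) * Real.sqrt ((δ - 2)/(δ + 2)) < h₀ := by
      have hca : ContinuousAt (fun δ : ℝ => (α/2) * Real.sqrt ((δ - 2)/(δ + 2))) 2 := by
        apply continuousAt_const.mul
        apply Real.continuous_sqrt.continuousAt.comp
        exact ContinuousAt.div (by fun_prop) (by fun_prop) (by norm_num)
      have hev : ∀ᶠ δ in 𝓝 (2:ℝ), (α/2) * Real.sqrt ((δ - 2)/(δ + 2)) < h₀ :=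
        hca.eventually_lt continuousAt_const (by simpa using hh0)
      have hev2 := (hev.filter_mono (nhdsWithin_le_nhds (s := Set.Ioi 2))).and self_mem_nhdsWithin
      obtain ⟨δ, h, h'⟩ := hev2.exists
      exact ⟨δ, h', h⟩
    obtain ⟨δ, h2, hδ0⟩ := hδex
    obtain ⟨γ, hγ1, hγ2⟩ : ∃ γ : ℝ, 1/(2*δ*α) < γ ∧ γ < 1/(4*α) := by
      apply exists_between
      apply one_div_lt_one_div_of_lt (by positivity)
      nlinarith
    have hγ : 0 < γ := lt_trans (by positivity) hγ1
    have hδ : 1/(2*γ*α) < δ := by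
      rw [div_lt_iff₀ (by positivity)] at hγ1 ⊢
      linarith
    obtain ⟨-, hd, h1, hm0, hmp, hp1, hm, hp, hm'⟩ := aux_main α γ δ hα hγ hγ2 hδ
    have hivt := intermediate_value_Ioo' hmp.le (aux_hcont α γ δ hα hγ hγ2 hδ)
    obtain ⟨t, ht, hte⟩ := hivt (show h₀ ∈ Set.Ioo _ _ by
      refine ⟨?_, ?_⟩
      · rw [aux_hp α γ δ hα hγ hγ2 hδ]; exact hδ0
      · rw [aux_hm α γ δ hα hγ hγ2 hδ]; exact hh1)
    exact ⟨γ, δ, t, hγ, hγ2, hδ, ht, hte⟩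
end

section
/- Let d ≥ 1 and s ≥ 1 be integers and let (v_n)_{n∈ℤ} be a sequence in ℤ² with det(v_n, v_{n+1}) = 1 for all n ∈ ℤ and v_{n+d} = (T*)^s v_n for all n ∈ ℤ, and suppose v_h is horizontal (i.e. v_h = (1,0) or v_h = (−1,0)) for some h ∈ {0, …, d−1}. Define a sequence (v̂_n)_{n∈ℤ} by v̂_ℓ = T* v_ℓ for 0 ≤ ℓ ≤ h−1, v̂_ℓ = v_ℓ for h ≤ ℓ ≤ d−1, and v̂_{n+d} = (T*)^{s−1} v̂_n for all n ∈ ℤ. Then det(v̂_n, v̂_{n+1}) = 1 for all n ∈ ℤ. (This is the combinatorial core of the paper's proposition that a semitoric system whose helix (d, s, [v]) contains a horizontal vector admits a semitoric type blowdown, with resulting helix (d, s−1, [v̂]).) -/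
/-- The matrix `T* = [[1,1],[0,1]]` acting on column vectors of ℤ²:
`T*(x, y) = (x + y, y)`. -/
def Tstar (v : ℤ × ℤ) : ℤ × ℤ := (v.1 + v.2, v.2)

/-- `det(v, w)`: the determinant of the 2×2 matrix with columns `v` and `w`. -/
def det2 (v w : ℤ × ℤ) : ℤ := v.1 * w.2 - v.2 * w.1

theorem det2_Tstar (v w : ℤ × ℤ) : det2 (Tstar v) (Tstar w) = det2 v w := by
  simp only [det2, Tstar]; ring

theorem det2_Tstar_iter (k : ℕ) (v w : ℤ × ℤ) :
    det2 (Tstar^[k] v) (Tstar^[k] w) = det2 v w := by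
  induction k with
  | zero => rfl
  | succ k ih => rw [Function.iterate_succ_apply', Function.iterate_succ_apply', det2_Tstar, ih]

/-- Combinatorial core of the semitoric-type blowdown on helices: if `(vₙ)` satisfies
`det(vₙ, vₙ₊₁) = 1` and `vₙ₊d = (T*)ˢ vₙ` and some `v_h` with `0 ≤ h ≤ d−1` is
horizontal, then the blowdown sequence `(v̂ₙ)` (equal to `T* vₗ` for `0 ≤ ℓ ≤ h−1`, to
`vₗ` for `h ≤ ℓ ≤ d−1`, and extended by `v̂ₙ₊d = (T*)^{s−1} v̂ₙ`) again satisfies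
`det(v̂ₙ, v̂ₙ₊₁) = 1` for all `n`. -/
theorem stmt16 (d s : ℕ) (hd : 1 ≤ d) (hs : 1 ≤ s)
    (v : ℤ → ℤ × ℤ)
    (hdet : ∀ n : ℤ, det2 (v n) (v (n + 1)) = 1)
    (hper : ∀ n : ℤ, v (n + d) = Tstar^[s] (v n))
    (h : ℕ) (hhd : h < d)
    (hhor : v (h : ℤ) = (1, 0) ∨ v (h : ℤ) = (-1, 0))
    (vhat : ℤ → ℤ × ℤ)
    (hlow : ∀ ℓ : ℤ, 0 ≤ ℓ → ℓ < (h : ℤ) → vhat ℓ = Tstar (v ℓ))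
    (hhigh : ∀ ℓ : ℤ, (h : ℤ) ≤ ℓ → ℓ < (d : ℤ) → vhat ℓ = v ℓ)
    (hper' : ∀ n : ℤ, vhat (n + d) = Tstar^[s - 1] (vhat n)) :
    ∀ n : ℤ, det2 (vhat n) (vhat (n + 1)) = 1 := by
  have hfix : Tstar (v h) = v h := by
    rcases hhor with e | e <;> simp [e, Tstar]
  have hlow' : ∀ ℓ : ℤ, 0 ≤ ℓ → ℓ ≤ (h : ℤ) → vhat ℓ = Tstar (v ℓ) := by
    intro l h0 h1
    rcases h1.lt_or_eq with h2 | h2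
    · exact hlow l h0 h2
    · subst h2
      rw [hfix]
      exact hhigh _ le_rfl (by exact_mod_cast hhd)
  have hdd : vhat d = v d := by
    have e1 := hper' 0
    have e2 := hper 0
    rw [zero_add] at e1 e2
    rw [e1, e2, hlow' 0 le_rfl (by positivity), ← Function.iterate_succ_apply]
    congr 2
    omega
  have hhigh' : ∀ ℓ : ℤ, (h : ℤ) ≤ ℓ → ℓ ≤ (d : ℤ) → vhat ℓ = v ℓ := by
    intro l h0 h1
    rcases h1.lt_or_eq with h2 | h2
    · exact hhigh l h0 h2
    · subst h2
      exact hdd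
  have base : ∀ n : ℤ, 0 ≤ n → n < d → det2 (vhat n) (vhat (n + 1)) = 1 := by
    intro n h0 h1
    rcases lt_or_ge n (h : ℤ) with h2 | h2
    · rw [hlow' n h0 h2.le, hlow' (n + 1) (by omega) (by omega), det2_Tstar, hdet]
    · rw [hhigh' n h2 h1.le, hhigh' (n + 1) (by omega) (by omega), hdet]
  have step : ∀ n : ℤ, det2 (vhat (n + d)) (vhat (n + d + 1)) = det2 (vhat n) (vhat (n + 1)) := by
    intro n
    rw [show n + (d : ℤ) + 1 = n + 1 + d by ring, hper', hper', det2_Tstar_iter]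
  have hper2 : Function.Periodic (fun n : ℤ => det2 (vhat n) (vhat (n + 1))) (d : ℤ) := step
  intro n
  have hd0 : (0 : ℤ) < d := by exact_mod_cast hd
  have e := hper2.int_mul (n / d) (n % d)
  have e3 : n % d + (n / d) * d = n := Int.emod_add_ediv_mul n d
  simp only [Int.cast_id, e3] at e
  rw [e]
  exact base _ (Int.emod_nonneg _ hd0.ne') (Int.emod_lt_of_pos _ hd0)
end

section
/- Let z = (z₁, z₂, z₃, z₄) ∈ ℂ⁴ satisfy |z₁|² + |z₃|² + |z₄|² = 2(2β − α) and |z₂|² + |z₄|² = 2β. Then −H_t(z) ≥ (|z₃|²/2)·(1 − 2t(1 − (2β − α)γδ)) ≥ 0, and H_t(z) = 0 if and only if z₃ = 0. In particular H_t ≤ 0 on the constraint set with maximum value 0 attained exactly on {z₃ = 0}, so the image of the ℤ₂-sphere {z₃ = 0} lies in the top boundary of the momentum map image of (J, H_t) for all t ∈ [0, 1]. -/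
/-- The Hamiltonian `H_t` on ℂ⁴ (descending to the type (3c) family on `W₁(β−α, β)`):
`H_t(z) = (2t − 1)|z₃|²/2 + 2γt(Re(z₁z̄₂z̄₃²z₄) + δ((|z₁|² + |z₄|²)/2)²) − 2γδt(2β−α)²`. -/
noncomputable def Ht3c (α β γ δ t : ℝ) (z : ℂ × ℂ × ℂ × ℂ) : ℝ :=
  (2*t - 1) * Complex.normSq z.2.2.1 / 2
    + 2*γ*t*((z.1 * (starRingEnd ℂ z.2.1) * (starRingEnd ℂ z.2.2.1)^2 * z.2.2.2).re
        + δ * ((Complex.normSq z.1 + Complex.normSq z.2.2.2)/2)^2)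
    - 2*γ*δ*t*(2*β - α)^2

/-- Let `z ∈ ℂ⁴` satisfy `|z₁|² + |z₃|² + |z₄|² = 2(2β − α)` and `|z₂|² + |z₄|² = 2β`.
Then `−H_t(z) ≥ (|z₃|²/2)(1 − 2t(1 − (2β − α)γδ)) ≥ 0`, so `H_t ≤ 0` on the constraint
set, and `H_t(z) = 0` iff `z₃ = 0`: the maximum value `0` is attained exactly on
`{z₃ = 0}`. -/
theorem stmt18 (α β γ δ t : ℝ) (hα : 0 < α) (hαβ : α < β)
    (hγ0 : 0 < γ) (hγ : γ < 1/(4*(2*β - α)*Real.sqrt (2*β)))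
    (hδ : max (1/(2*(2*β - α)*γ)) ((6*β - α)/Real.sqrt (2*β)) < δ)
    (ht0 : 0 ≤ t) (ht1 : t ≤ 1)
    (z : ℂ × ℂ × ℂ × ℂ)
    (hz1 : Complex.normSq z.1 + Complex.normSq z.2.2.1 + Complex.normSq z.2.2.2
      = 2*(2*β - α))
    (hz2 : Complex.normSq z.2.1 + Complex.normSq z.2.2.2 = 2*β) :
    (Complex.normSq z.2.2.1 / 2) * (1 - 2*t*(1 - (2*β - α)*γ*δ)) ≤ -(Ht3c α β γ δ t z) ∧
    0 ≤ (Complex.normSq z.2.2.1 / 2) * (1 - 2*t*(1 - (2*β - α)*γ*δ)) ∧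
    Ht3c α β γ δ t z ≤ 0 ∧
    (Ht3c α β γ δ t z = 0 ↔ z.2.2.1 = 0) := by
  obtain ⟨z1, z2, z3, z4⟩ := z
  simp only [Ht3c] at *
  have hβ : 0 < β := hα.trans hαβ
  have hm : 0 < 2*β - α := by linarith
  obtain ⟨hδ1, hδ2⟩ := max_lt_iff.mp hδ
  have hr : 0 < Real.sqrt (2*β) := Real.sqrt_pos.mpr (by linarith)
  have hr2 : Real.sqrt (2*β) ^ 2 = 2*β := Real.sq_sqrt (by linarith)
  rw [div_lt_iff₀ hr] at hδ2
  rw [div_lt_iff₀ (by positivity)] at hδ1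
  have hδr : 2 * Real.sqrt (2*β) ≤ δ := by
    by_contra h
    push Not at h
    nlinarith
  have hδ0 : 0 < δ := by linarith
  have hb : ‖z2‖ ≤ Real.sqrt (2*β) := by
    apply Real.le_sqrt_of_sq_le
    rw [← Complex.normSq_eq_norm_sq]
    linarith [Complex.normSq_nonneg z4]
  have hre : (z1 * (starRingEnd ℂ z2) * (starRingEnd ℂ z3)^2 * z4).re
      ≤ ‖z1‖ * ‖z2‖ * ‖z3‖^2 * ‖z4‖ := by
    refine (Complex.re_le_norm _).trans (le_of_eq ?_)
    simp
  have key : (z1 * (starRingEnd ℂ z2) * (starRingEnd ℂ z3)^2 * z4).re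
      ≤ δ / 4 * ‖z3‖^2 * (‖z1‖^2 + ‖z4‖^2) := by
    have h2 : ‖z2‖ ≤ δ / 2 := by linarith
    have h3 : ‖z1‖ * ‖z4‖ ≤ (‖z1‖^2 + ‖z4‖^2) / 2 := by nlinarith [sq_nonneg (‖z1‖ - ‖z4‖)]
    have h4 : ‖z2‖ * (‖z1‖ * ‖z4‖) ≤ δ / 2 * ((‖z1‖^2 + ‖z4‖^2) / 2) := by gcongr
    have h5 := mul_le_mul_of_nonneg_left h4 (sq_nonneg ‖z3‖)
    linarith
  have hpos : 0 < 1 - 2*t*(1 - (2*β - α)*γ*δ) := by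
    rcases ht0.eq_or_lt with h | h
    · subst h; norm_num
    · nlinarith
  rw [← Complex.normSq_eq_norm_sq, ← Complex.normSq_eq_norm_sq, ← Complex.normSq_eq_norm_sq] at key
  have hs0 : 0 ≤ Complex.normSq z3 := Complex.normSq_nonneg z3
  have hz : z3 = 0 ↔ Complex.normSq z3 = 0 := Complex.normSq_eq_zero.symm
  have hre0 : z3 = 0 → (z1 * (starRingEnd ℂ z2) * (starRingEnd ℂ z3)^2 * z4).re = 0 := by
    rintro rfl; simp
  generalize (z1 * (starRingEnd ℂ z2) * (starRingEnd ℂ z3)^2 * z4).re = R at *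
  generalize Complex.normSq z3 = s at *
  have had : Complex.normSq z1 + Complex.normSq z4 = 2*(2*β - α) - s := by linarith
  rw [had] at key ⊢
  have A : (s / 2) * (1 - 2*t*(1 - (2*β - α)*γ*δ)) ≤
      -((2*t - 1) * s / 2 + 2*γ*t*(R + δ * ((2*(2*β - α) - s)/2)^2) - 2*γ*δ*t*(2*β - α)^2) := by
    have := mul_le_mul_of_nonneg_left key (by positivity : 0 ≤ 2*γ*t)
    linarith
  have B : 0 ≤ (s / 2) * (1 - 2*t*(1 - (2*β - α)*γ*δ)) := by positivity
  refine ⟨A, B, by linarith, fun h => ?_, fun h => ?_⟩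
  · rw [hz]
    rw [h] at A
    by_contra hne
    have : 0 < s := lt_of_le_of_ne hs0 (Ne.symm hne)
    have : 0 < (s / 2) * (1 - 2*t*(1 - (2*β - α)*γ*δ)) := by positivity
    linarith
  · rw [hre0 h, hz.mp h]; ring
end

section
/- For every j with β − α ≤ j < 3β − α and every X ∈ (X⁻(j), X⁺(j)), one has f(X) − g(X) > 0; in particular f − g does not vanish on (X⁻(j), X⁺(j)). (In the paper's type (3c) system on W₁(β−α, β), this says that for every t ∈ (0, t⁺) the reduced Hamiltonian at the levels J = j with j ≥ β − α has no critical point with cos θ = 1, which rules out hyperbolic-regular points and flaps over those levels.) -/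
/-- `f(X) = 2(1 − 2t + 4γδt(X + β − j))·√(X(2j − X)(2(β − j) + X))` for the type (3c)
system on `W₁(β−α, β)`. -/
noncomputable def f3c (β γ δ t j X : ℝ) : ℝ :=
  2*(1 - 2*t + 4*γ*δ*t*(X + β - j)) * Real.sqrt (X*(2*j - X)*(2*(β - j) + X))

/-- `g(X) = −4γt(5X³ + (3α + 5β − 19j)X² + 4(αβ + 5j² − 2jβ − 2jα − β²)X
+ 4j(β − j)(β − α + j))` for the type (3c) system. -/
noncomputable def g3c (α β γ t j X : ℝ) : ℝ :=
  -4*γ*t*(5*X^3 + (3*α + 5*β - 19*j)*X^2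
      + 4*(α*β + 5*j^2 - 2*j*β - 2*j*α - β^2)*X + 4*j*(β - j)*(β - α + j))

lemma le_of_sq_le_sq_aux {a b : ℝ} (h : a^2 ≤ b^2) (hb : 0 ≤ b) : a ≤ b := by
  by_contra hh
  push Not at hh
  nlinarith

lemma aux_F_s19 (r s : ℝ) (hr0 : 0 ≤ r) (hr1 : r ≤ 1) (hs0 : 0 ≤ s) (hs1 : s ≤ 1) :
    0 ≤ s^3*(1-r)^2 + r*(1-s)*((1+s)*((1+r^2)*(1+s^2) + (1+r^2)^2*(1-s^2)/2 - 3*r*s) - 2*s^2) := by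
  rcases le_total s (4/5) with h | h
  · have hG : 0 ≤ (1+s)*((1+r^2)*(1+s^2) + (1+r^2)^2*(1-s^2)/2 - 3*r*s) - 2*s^2 := by
      have h1 : (1+r^2)*(1+s^2) + (1+r^2)*(1-s^2)/2 - 3*r*s ≥ 2*s^2/(1+s) := by
        rw [ge_iff_le, div_le_iff₀ (by linarith)]
        nlinarith [sq_nonneg (r*(3+s^2) - 3*s), mul_nonneg hs0 (sub_nonneg.2 h), mul_nonneg (mul_nonneg hs0 hs0) (sub_nonneg.2 h), sq_nonneg (r-s), sq_nonneg (r - 3/4), mul_nonneg hs0 (sq_nonneg (r-s)), mul_nonneg hs0 (sq_nonneg (r-3/4))]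
      rw [ge_iff_le, div_le_iff₀ (by linarith)] at h1
      have h2 : 0 ≤ (1+s)*((1-s^2)*((1+r^2)^2-(1+r^2))) := by
        have : 0 ≤ 1 - s^2 := by nlinarith
        have : (0:ℝ) ≤ (1+r^2)^2-(1+r^2) := by nlinarith [sq_nonneg r, sq_nonneg (r^2)]
        positivity
      nlinarith
    have : 0 ≤ 1 - s := by linarith
    have : 0 ≤ 1 - r := by linarith
    positivity
  · have h1s : 0 ≤ 1 - s := by linarith
    have h1r : 0 ≤ 1 - r := by linarith
    rcases le_total r (1/2) with h' | h'
    · have hG : 0 ≤ (1+s)*((1+r^2)*(1+s^2) + (1+r^2)^2*(1-s^2)/2 - 3*r*s) - 2*s^2 := by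
        have h1 : s ≤ (1+r^2)*(1+s^2) - 3*r*s := by
          nlinarith [mul_nonneg h1s hr0, sq_nonneg (r*s), mul_nonneg (sub_nonneg.2 h') h1r, sq_nonneg (s-1), mul_nonneg (mul_nonneg (sub_nonneg.2 h') h1r) hs0, sq_nonneg (r*(1-s))]
        have h2 : 0 ≤ (1+r^2)^2*(1-s^2)/2 := by
          have : 0 ≤ 1 - s^2 := by nlinarith
          positivity
        nlinarith
      positivity
    · have hG : -2*(1-r) + 4*(1-s) ≤ (1+s)*((1+r^2)*(1+s^2) + (1+r^2)^2*(1-s^2)/2 - 3*r*s) - 2*s^2 := by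
        have g1 : 0 ≤ (1+s)^2*(1-s)*((1+r^2)^2/2 - (2-4*(1-r))) := by
          apply mul_nonneg (by positivity)
          nlinarith [sq_nonneg (r^2-1), sq_nonneg (r-1)]
        obtain ⟨a, rfl⟩ : ∃ a, r = 1 - a := ⟨1-r, by ring⟩
        obtain ⟨b, rfl⟩ : ∃ b, s = 1 - b := ⟨1-s, by ring⟩
        have hb0 : 0 ≤ b := by linarith
        have hb1 : b ≤ 1/5 := by linarith
        have ha0 : 0 ≤ a := by linarith
        have g2 : 0 ≤ (1+(1-b))*((2-2*a+a^2)*(1+(1-b)^2) - 3*(1-a)*(1-b)) - 2*(1-b)^2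
            + (1+(1-b))^2*b*(2-4*a) + 2*a - 4*b := by
          have x1 : 0 ≤ a^2*((1+(1-b))*(1+(1-b)^2) - 5/2) := by
            apply mul_nonneg (by positivity)
            nlinarith [mul_nonneg hb0 (sub_nonneg.2 hb1)]
          have x2 : (1+(1-b))*(-2-2*(1-b)^2+3*(1-b)) -4*(1+(1-b))^2*b+2 ≥ -16*b := by
            nlinarith [mul_nonneg hb0 (sub_nonneg.2 hb1), mul_nonneg hb0 (mul_nonneg hb0 (sub_nonneg.2 hb1))]
          have x3 := mul_le_mul_of_nonneg_left x2 ha0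
          nlinarith [sq_nonneg (5*a - 16*b), mul_nonneg hb0 (sub_nonneg.2 hb1)]
        nlinarith
      have h3 : (1/2:ℝ) ≤ s^3 := by
        calc (1/2:ℝ) ≤ (4/5)^3 := by norm_num
          _ ≤ s^3 := by gcongr
      have h4 := mul_le_mul_of_nonneg_left hG (mul_nonneg hr0 h1s)
      have h5 := mul_le_mul_of_nonneg_right h3 (sq_nonneg (1-r))
      nlinarith [mul_nonneg hr0 (sq_nonneg ((1-r) - 2*(1-s))), mul_nonneg h1r (sq_nonneg (1-r))]

set_option maxHeartbeats 1000000 in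
lemma core (c u m : ℝ) (h1 : m < u) (h2 : -m < u) (h3 : u < c) (h4 : c ≤ 1) (h5 : c ≤ 1 - m) :
    0 ≤ 2*((2+c)*u - c)*Real.sqrt ((u^2-m^2)*(1-m-u))
      + (2*u*(1-m-u) - (u^2-m^2))*(c-u) - 2*((u^2-m^2)*(1-m-u)) := by
  have hu : 0 < u := by linarith
  have hq2 : 0 < u^2-m^2 := by nlinarith
  have hw : 0 < 1-m-u := by linarith
  obtain ⟨q, hq0, hq⟩ : ∃ q, 0 < q ∧ q^2 = u^2-m^2 :=
    ⟨Real.sqrt (u^2-m^2), Real.sqrt_pos.2 hq2, Real.sq_sqrt hq2.le⟩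
  obtain ⟨s, hs0, hs⟩ : ∃ s, 0 < s ∧ s^2 = 1-m-u :=
    ⟨Real.sqrt (1-m-u), Real.sqrt_pos.2 hw, Real.sq_sqrt hw.le⟩
  have hsq : Real.sqrt ((u^2-m^2)*(1-m-u)) = q*s := by
    rw [← hq, ← hs, ← mul_pow, Real.sqrt_sq (by positivity)]
  rw [hsq, ← hq, ← hs]
  have hqu : q ≤ u := by
    apply le_of_sq_le_sq_aux ?_ hu.le
    nlinarith [sq_nonneg m]
  have hs1 : s ≤ 1 := by
    apply le_of_sq_le_sq_aux ?_ zero_le_one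
    nlinarith
  -- c = u endpoint
  have e0 : 0 ≤ 2*((2+u)*u - u)*(q*s) - 2*(q^2*s^2) := by
    have : q*s ≤ u := by nlinarith
    have : 0 ≤ (q*s)*(u+u^2-q*s) := mul_nonneg (by positivity) (by nlinarith)
    nlinarith
  have e1 : ∃ d, c ≤ d ∧ 0 ≤ 2*((2+d)*u - d)*(q*s) + (2*u*s^2 - q^2)*(d-u) - 2*(q^2*s^2) := by
    rcases le_total m 0 with hm | hm
    · refine ⟨1, h4, ?_⟩
      have hu1 : u < 1 := by linarith
      obtain ⟨v, hv0, hv⟩ : ∃ v, 0 ≤ v ∧ v^2 = 1-u :=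
        ⟨Real.sqrt (1-u), Real.sqrt_nonneg _, Real.sq_sqrt (by linarith)⟩
      have hvs : v ≤ s := by
        apply le_of_sq_le_sq_aux ?_ hs0.le
        nlinarith
      have hv1 : v ≤ 1 := hvs.trans hs1
      have huv : u = 1 - v^2 := by linarith
      have k1 : 0 ≤ s^2*(2-4*u) + 2*(3*u-1)*s - u*(1-u) := by
        have k0 : 0 ≤ v*((1-v)^2*(4+5*v)) := by positivity
        have k0' : v^2*(2-4*u) + 2*(3*u-1)*v - u*(1-u) = v*((1-v)^2*(4+5*v)) := by
          rw [huv]; ring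
        have k2 : 0 ≤ (s-v)*((s+v)*(2-4*u) + 2*(3*u-1)) := by
          apply mul_nonneg (by linarith)
          rcases le_total u (1/2) with h | h
          · have : v^2 ≤ v := by nlinarith
            have : 0 ≤ (s+v-2*(1-u))*(2-4*u) := mul_nonneg (by linarith) (by linarith)
            nlinarith [sq_nonneg (u - 3/8)]
          · nlinarith
        nlinarith
      -- concavity in q
      have : 0 ≤ q*(s^2*(2-4*u) + 2*(3*u-1)*s - u*(1-u)) := by positivity
      have : 0 ≤ (u-q)*(2*s^2*(1-u)) := mul_nonneg (by linarith) (mul_nonneg (by positivity) (by linarith))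
      have : 0 ≤ q*((u-q)*((1-u)+2*s^2)) := mul_nonneg hq0.le (mul_nonneg (by linarith) (add_nonneg (by linarith) (by positivity)))
      nlinarith
    · refine ⟨1-m, h5, ?_⟩
      have hk : 0 < 1 - s^2 := by linarith
      obtain ⟨r, hr⟩ : ∃ r, q = (1-s^2)*r := ⟨q/(1-s^2), by field_simp⟩
      have hr0 : 0 ≤ r := by
        by_contra hh
        push Not at hh
        nlinarith
      have hmm : m = 1 - s^2 - u := by linarith
      have hu' : u = (1-s^2)*(1+r^2)/2 := by
        rw [hmm, hr] at hq
        have : (1-s^2)*(2*u) = (1-s^2)*((1-s^2)*(1+r^2)) := by nlinarith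
        have := mul_left_cancel₀ hk.ne' this
        linarith
      have hr1 : r ≤ 1 := by
        by_contra hh
        push Not at hh
        nlinarith [mul_pos hk (sub_pos.2 hh), mul_pos hk (mul_pos (sub_pos.2 hh) (sub_pos.2 hh))]
      have hF := aux_F_s19 r s hr0 hr1 hs0.le hs1
      have : 0 ≤ (1-s^2)*s*(s^3*(1-r)^2 + r*(1-s)*((1+s)*((1+r^2)*(1+s^2) + (1+r^2)^2*(1-s^2)/2 - 3*r*s) - 2*s^2)) :=
        mul_nonneg (by positivity) hF
      refine this.trans_eq ?_
      rw [hmm, hr, hu']; ring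
  obtain ⟨d, hcd, e1⟩ := e1
  have hud : 0 < d - u := by linarith
  have : 0 ≤ (d-u)*(2*((2+c)*u - c)*(q*s) + (2*u*s^2 - q^2)*(c-u) - 2*(q^2*s^2)) := by
    have a1 := mul_nonneg (sub_nonneg.2 hcd) e0
    have a2 := mul_nonneg (sub_nonneg.2 h3.le) e1
    have a3 := add_nonneg a1 a2
    refine a3.trans_eq ?_
    ring
  exact nonneg_of_mul_nonneg_right this hud

/-- For every `j` with `β − α ≤ j < 3β − α` and every `X ∈ (X⁻(j), X⁺(j))`, where
`X⁻(j) = max(0, 2(j − β))` and `X⁺(j) = min(2j, j + β − α)`, one has `f(X) − g(X) > 0`;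
in particular `f − g` does not vanish on `(X⁻(j), X⁺(j))`. -/
theorem stmt19 (α β γ δ t : ℝ) (hα : 0 < α) (hαβ : α < β)
    (hγ0 : 0 < γ) (hγ : γ < 1/(4*(2*β - α)*Real.sqrt (2*β)))
    (hδ : max (1/(2*(2*β - α)*γ)) ((6*β - α)/Real.sqrt (2*β)) < δ)
    (ht0 : 0 < t) (htp : t < 1/(2*(1 - 2*γ*(2*β - α)*Real.sqrt (2*β))))
    (j : ℝ) (hj1 : β - α ≤ j) (hj2 : j < 3*β - α)
    (X : ℝ) (hX1 : max 0 (2*(j - β)) < X) (hX2 : X < min (2*j) (j + β - α)) :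
    0 < f3c β γ δ t j X - g3c α β γ t j X := by
  obtain ⟨hX0, hXj⟩ := max_lt_iff.1 hX1
  obtain ⟨hX2j, hXa⟩ := lt_min_iff.1 hX2
  have hδ2 := (max_lt_iff.1 hδ).2
  have hB : 0 < 2*β := by linarith
  obtain ⟨R, hRd⟩ : ∃ R, R = Real.sqrt (2*β) := ⟨_, rfl⟩
  have hR0 : 0 < R := hRd ▸ Real.sqrt_pos.2 hB
  have hR2 : R^2 = 2*β := hRd ▸ Real.sq_sqrt hB.le
  rw [← hRd] at hγ hδ2 htp
  have hc : 0 < 2*β - α := by linarith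
  rw [lt_div_iff₀ (by positivity)] at hγ
  rw [div_lt_iff₀ hR0] at hδ2
  have hpos : 0 < 2*(1 - 2*γ*(2*β - α)*R) := by nlinarith
  rw [lt_div_iff₀ hpos] at htp
  obtain ⟨u, hu⟩ : ∃ u, u = (X + β - j)/(2*β) := ⟨_, rfl⟩
  obtain ⟨m, hm⟩ : ∃ m, m = (β - j)/(2*β) := ⟨_, rfl⟩
  obtain ⟨c, hcc⟩ : ∃ c, c = (2*β - α)/(2*β) := ⟨_, rfl⟩
  have hu' : X + β - j = R^2*u := by rw [hu, hR2, mul_div_cancel₀ _ hB.ne']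
  have hm' : β - j = R^2*m := by rw [hm, hR2, mul_div_cancel₀ _ hB.ne']
  have hc' : 2*β - α = R^2*c := by rw [hcc, hR2, mul_div_cancel₀ _ hB.ne']
  have hR2p : 0 < R^2 := by positivity
  have h1 : m < u := lt_of_mul_lt_mul_left (by linarith : R^2*m < R^2*u) hR2p.le
  have h2 : -m < u := lt_of_mul_lt_mul_left (by linarith : R^2*(-m) < R^2*u) hR2p.le
  have h3 : u < c := lt_of_mul_lt_mul_left (by linarith : R^2*u < R^2*c) hR2p.le
  have h4 : c ≤ 1 := le_of_mul_le_mul_left (by linarith : R^2*c ≤ R^2*1) hR2p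
  have h5 : c ≤ 1 - m := le_of_mul_le_mul_left (by linarith : R^2*c ≤ R^2*(1-m)) hR2p
  have hcore := core c u m h1 h2 h3 h4 h5
  have hA : 0 < (u^2-m^2)*(1-m-u) := mul_pos (by nlinarith) (by linarith)
  obtain ⟨T, hT⟩ : ∃ T, T = Real.sqrt ((u^2-m^2)*(1-m-u)) := ⟨_, rfl⟩
  have hT0 : 0 < T := hT ▸ Real.sqrt_pos.2 hA
  rw [← hT] at hcore
  have hβ' : β = R^2/2 := by linarith
  have hj' : j = R^2/2 - R^2*m := by linarith
  have hX' : X = R^2*u - R^2*m := by linarith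
  have hα' : α = R^2 - R^2*c := by linarith
  have hS : Real.sqrt (X*(2*j - X)*(2*(β - j) + X)) = R^3*T := by
    rw [hT, hX', hj', hβ', ← Real.sqrt_sq (by positivity : 0 ≤ R^3), ← Real.sqrt_mul (by positivity)]
    congr 1; ring
  have hu0 : 0 < u := by linarith
  unfold f3c g3c
  rw [hS, hu']
  have hδ3 : R*(2+c) < δ := by
    refine lt_of_mul_lt_mul_right (?_ : R*(2+c)*R < δ*R) hR0.le
    have : R*(2+c)*R = 2*R^2 + R^2*c := by ring
    linarith
  have ht3 : 0 < 1 - 2*t + 4*γ*t*(R^3*c) := by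
    rw [hc'] at htp
    have : t*(2*(1 - 2*γ*(R^2*c)*R)) = 2*t - 4*γ*t*(R^3*c) := by ring
    linarith
  have b1 : 0 < 2*(1 - 2*t + 4*γ*t*(R^3*c))*(R^3*T) := by positivity
  have b2 : 0 < 8*γ*t*(δ - R*(2+c))*(R^2*u)*(R^3*T) := by
    have := sub_pos.2 hδ3
    positivity
  have b3 := mul_nonneg (by positivity : 0 ≤ 4*γ*t*R^6) hcore
  have b := add_pos_of_pos_of_nonneg (add_pos b1 b2) b3
  refine b.trans_eq ?_
  rw [hα', hX', hj', hβ']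
  ring
end
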